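/- Let l ≥ 1 and n ≥ 4l+2 be integers. Then the set of points p ∈ P_n such that there exists an inscribed equilateral (2l+1)-pointed star based at p with side length in (0, r_n] containing a vertex of P_n among its points is finite with exactly lcm(n, 2l+1) elements. The same conclusion holds with 'midpoint of an edge of P_n' in place of 'vertex of P_n'. -/

import Mathlib

noncomputable section

/-- The primitive `n`-th root of unity `ω = exp(2πi/n)`. -/
def nroot (n : ℕ) : ℂ := Complex.exp (2 * Real.pi * Complex.I / n)

/-- The boundary of the regular `n`-gon inscribed in the unit circle, as a subset of `ℂ`:
the union of the closed segments from `ω^j` to `ω^(j+1)` for `j = 0, …, n-1`. -/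
def polygon (n : ℕ) : Set ℂ :=
  ⋃ j ∈ Finset.range n, segment ℝ ((nroot n) ^ j) ((nroot n) ^ (j + 1))

/-- The critical scale `r_n`: `2 cos(π/n)` for even `n`,
and `1 + cos(2π/n)/cos(π/n)` for odd `n`. -/
def rpoly (n : ℕ) : ℝ :=
  if Even n then 2 * Real.cos (Real.pi / n)
  else 1 + Real.cos (2 * Real.pi / n) / Real.cos (Real.pi / n)

/-- Arc-length parametrization of the polygon `P_n` by the parameter `t` (normalized so that
`t ∈ [0,1)` traverses the polygon once counterclockwise, with vertices at `t = j/n`). -/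
def polyParam (n : ℕ) (t : ℝ) : ℂ :=
  ((1 - Int.fract (n * t) : ℝ) : ℂ) * (nroot n) ^ (⌊(n : ℝ) * t⌋) +
    ((Int.fract (n * t) : ℝ) : ℂ) * (nroot n) ^ (⌊(n : ℝ) * t⌋ + 1)

/-- The parameter value in `[0,1)` of a point `x ∈ P_n`. -/
def polyArg (n : ℕ) (x : ℂ) : ℝ :=
  sInf {t : ℝ | t ∈ Set.Ico (0 : ℝ) 1 ∧ polyParam n t = x}

/-- The normalized counterclockwise arc distance from `x` to `y` along `P_n`: the length of the
counterclockwise path along `P_n` from `x` to `y` divided by the total perimeter of `P_n`. -/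
def polyDist (n : ℕ) (x y : ℂ) : ℝ := Int.fract (polyArg n y - polyArg n x)

/-- `z` is strictly counterclockwise-between `x` and `y` on `P_n`. -/
def SCCWBtw (n : ℕ) (x z y : ℂ) : Prop :=
  0 < polyDist n x z ∧ polyDist n x z < polyDist n x y

/-- An inscribed equilateral `(2l+1)`-pointed star of side length `r` based at `p ∈ P_n`:
a tuple `(u 0, …, u (2l+1))` of points of `P_n` with `u 0 = u (2l+1) = p`, where consecutive
points are at Euclidean distance `r`, every point of `P_n` strictly counterclockwise-between
`u i` and `u (i+1)` is at distance `< r` from `u i`, and the total winding number is `l`. -/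
def IsStar (n l : ℕ) (r : ℝ) (p : ℂ) (u : ℕ → ℂ) : Prop :=
  u 0 = p ∧ u (2 * l + 1) = p ∧
  (∀ i ≤ 2 * l + 1, u i ∈ polygon n) ∧
  (∀ i ≤ 2 * l, dist (u i) (u (i + 1)) = r) ∧
  (∀ i ≤ 2 * l, ∀ z ∈ polygon n, SCCWBtw n (u i) z (u (i + 1)) → dist (u i) z < r) ∧
  (∑ i ∈ Finset.range (2 * l + 1), polyDist n (u i) (u (i + 1))) = (l : ℝ)

/-- `x` is a vertex of `P_n`. -/
def IsVertex (n : ℕ) (x : ℂ) : Prop := ∃ j < n, x = (nroot n) ^ j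

/-- `x` is the midpoint of an edge of `P_n`. -/
def IsMidpoint (n : ℕ) (x : ℂ) : Prop :=
  ∃ j < n, x = ((nroot n) ^ j + (nroot n) ^ (j + 1)) / 2

end

/-- The abstract properties of the chord length `D x y` between the points with parameters `x` and
`y` on a regular polygon whose edges are parametrized by unit intervals. -/
structure IsChordFun (D : ℝ → ℝ → ℝ) (β R : ℝ) : Prop where
  cont : Continuous fun p : ℝ × ℝ => D p.1 p.2
  self : ∀ x, D x x = 0
  shift : ∀ x y, D (x + 1) (y + 1) = D x y
  reflect : ∀ x y, D (-y) (-x) = D x y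
  anti_edge : ∀ x x' z, 0 ≤ x → x < x' → x' ≤ 1 → x' ≤ z → z ≤ β → D x' z < D x z
  at_level : D 1 β = R
  le_zero : ∀ x t, 0 ≤ t → D x (x + t) ≤ D 0 t
  one_le : 1 ≤ β
  pos : 0 < R

/-- The first parameter `y ≥ x` at chord length at least `r` from `x`. -/
noncomputable def nextPt (D : ℝ → ℝ → ℝ) (r x : ℝ) : ℝ := sInf {y | x ≤ y ∧ r ≤ D x y}

/-- The last parameter `x ≤ y` at chord length at least `r` from `y`, for symmetric `D`. -/
noncomputable def prevPt (D : ℝ → ℝ → ℝ) (r y : ℝ) : ℝ := -nextPt D r (-y)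

namespace IsChordFun

variable {D : ℝ → ℝ → ℝ} {β R r r' x x' y z : ℝ}

theorem shift_int (h : IsChordFun D β R) (x y : ℝ) (j : ℤ) : D (x + j) (y + j) = D x y := by
  induction j using Int.induction_on with
  | zero => simp
  | succ i ih => rw [← ih, ← h.shift (x + (i : ℤ))]; push_cast; ring_nf
  | pred i ih => rw [← ih, ← h.shift]; push_cast; ring_nf

theorem anti_int (h : IsChordFun D β R) (j : ℤ) (h0 : j ≤ x) (hx : x < x') (h1 : x' ≤ j + 1)
    (hz : x' ≤ z) (hb : z ≤ j + β) : D x' z < D x z := by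
  have := h.anti_edge (x - j) (x' - j) (z - j) (by linarith) (by linarith) (by linarith)
    (by linarith) (by linarith)
  rwa [← h.shift_int _ _ j, ← h.shift_int (x - j) _ j, sub_add_cancel, sub_add_cancel,
    sub_add_cancel] at this

theorem anti (h : IsChordFun D β R) (hx : x < x') (hz : x' ≤ z) (hb : z ≤ ⌊x⌋ + β) :
    D x' z < D x z := by
  have key : ∀ (N : ℕ) (x' : ℝ), x < x' → x' ≤ z → x' ≤ ⌊x⌋ + 1 + N → D x' z < D x z := by
    intro N
    induction N with
    | zero =>
      intro x' hx hz hN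
      exact h.anti_int ⌊x⌋ (Int.floor_le x) hx (by simpa using hN) hz hb
    | succ N ih =>
      intro x' hx hz hN
      by_cases hN' : x' ≤ ⌊x⌋ + 1 + N
      · exact ih x' hx hz hN'
      push Not at hN'
      have h1 := Int.lt_floor_add_one x
      have h2 : (0 : ℝ) ≤ N := N.cast_nonneg
      refine lt_trans (h.anti_int (⌊x⌋ + 1 + N) (x := ⌊x⌋ + 1 + N) (by push_cast; rfl) hN' ?_ hz ?_)
        (ih _ (by linarith) (by linarith) le_rfl)
      · push_cast at hN ⊢; linarith
      · push_cast; linarith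
  refine key ⌈x' - x⌉₊ x' hx hz ?_
  have := Nat.le_ceil (x' - x)
  have h1 := Int.lt_floor_add_one x
  linarith

theorem le_level (h : IsChordFun D β R) (j : ℤ) (h0 : j ≤ x) (h1 : x ≤ j + 1) :
    R ≤ D x (j + β) := by
  have e : D (j + 1) (j + β) = R := by
    rw [← h.at_level, ← h.shift_int 1 β j, add_comm, add_comm β]
  rcases h1.eq_or_lt with rfl | h1
  · exact e.ge
  · rw [← e]
    exact (h.anti_int j h0 h1 le_rfl (by linarith [h.one_le]) le_rfl).le

theorem cont_right (h : IsChordFun D β R) (x : ℝ) : Continuous (D x) :=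
  h.cont.comp (by fun_prop : Continuous fun y : ℝ => (x, y))

theorem nextPt_le (hy : x ≤ y) (hr : r ≤ D x y) : nextPt D r x ≤ y :=
  csInf_le ⟨x, fun _ hz => hz.1⟩ ⟨hy, hr⟩

theorem nextPt_le_level (h : IsChordFun D β R) (hr : r ≤ R) (j : ℤ) (h0 : j ≤ x)
    (h1 : x ≤ j + 1) : nextPt D r x ≤ j + β :=
  nextPt_le (by linarith [h.one_le]) (hr.trans (h.le_level j h0 h1))

theorem nextPt_mem (h : IsChordFun D β R) (hr : r ≤ R) (x : ℝ) :
    nextPt D r x ∈ {y | x ≤ y ∧ r ≤ D x y} := by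
  refine IsClosed.csInf_mem ?_ ?_ ⟨x, fun _ hz => hz.1⟩
  · exact (isClosed_le continuous_const continuous_id).inter
      (isClosed_le continuous_const (h.cont_right x))
  · have h1 := Int.lt_floor_add_one x
    exact ⟨⌊x⌋ + β, by linarith [h.one_le],
      hr.trans (h.le_level ⌊x⌋ (Int.floor_le x) h1.le)⟩

theorem le_nextPt (h : IsChordFun D β R) (hr : r ≤ R) (x : ℝ) : x ≤ nextPt D r x :=
  (h.nextPt_mem hr x).1

theorem lt_of_lt_nextPt (hxy : x ≤ y) (hy : y < nextPt D r x) : D x y < r := by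
  by_contra! hr
  exact absurd (nextPt_le hxy hr) hy.not_ge

theorem nextPt_of_nonpos (h : IsChordFun D β R) (hr : r ≤ 0) (x : ℝ) : nextPt D r x = x :=
  le_antisymm (nextPt_le le_rfl (by rwa [h.self])) (h.le_nextPt (hr.trans h.pos.le) x)

theorem chord_nextPt (h : IsChordFun D β R) (h0 : 0 ≤ r) (hr : r ≤ R) (x : ℝ) :
    D x (nextPt D r x) = r := by
  refine le_antisymm ?_ (h.nextPt_mem hr x).2
  rcases (h.le_nextPt hr x).eq_or_lt with e | hlt
  · rw [← e, h.self]; exact h0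
  · have ht : Filter.Tendsto (D x) (nhdsWithin (nextPt D r x) (Set.Iio (nextPt D r x)))
        (nhds (D x (nextPt D r x))) := ((h.cont_right x).tendsto _).mono_left nhdsWithin_le_nhds
    refine le_of_tendsto ht ?_
    filter_upwards [Ioo_mem_nhdsLT hlt] with y hy
    exact (lt_of_lt_nextPt hy.1.le hy.2).le

theorem nextPt_eq (h : IsChordFun D β R) (h0 : 0 < r) (hr : r ≤ R) (hxy : x ≤ y) (hD : D x y = r)
    (hz : ∀ z, x < z → z < y → D x z < r) : nextPt D r x = y := by
  refine le_antisymm (nextPt_le hxy hD.ge) ?_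
  by_contra! hlt
  have hm := h.nextPt_mem hr x
  rcases hm.1.eq_or_lt with e | hl
  · have := hm.2
    rw [← e, h.self] at this
    linarith
  · exact absurd hm.2 (hz _ hl hlt).not_ge

theorem nextPt_add_int (h : IsChordFun D β R) (hr : r ≤ R) (x : ℝ) (j : ℤ) :
    nextPt D r (x + j) = nextPt D r x + j := by
  have key : ∀ (x : ℝ) (j : ℤ), nextPt D r (x + j) ≤ nextPt D r x + j := by
    intro x j
    have hm := h.nextPt_mem hr x
    exact nextPt_le (by linarith [hm.1]) (by rw [h.shift_int]; exact hm.2)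
  refine le_antisymm (key x j) ?_
  have := key (x + j) (-j)
  push_cast at this
  rw [add_neg_cancel_right] at this
  linarith

theorem strictMono_nextPt (h : IsChordFun D β R) (hr : r ≤ R) : StrictMono (nextPt D r) := by
  rcases le_or_gt r 0 with h0 | h0
  · intro x x' hx
    rwa [h.nextPt_of_nonpos h0, h.nextPt_of_nonpos h0]
  have edge : ∀ (j : ℤ) (x x' : ℝ), j ≤ x → x < x' → x' ≤ j + 1 →
      nextPt D r x < nextPt D r x' := by
    intro j x x' hj hx hx'
    by_contra! hle
    have hm := h.nextPt_mem hr x'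
    have hb := h.nextPt_le_level hr j hj (hx.le.trans hx')
    have hlt := h.anti_int j hj hx hx' hm.1 (hle.trans hb)
    rcases hle.eq_or_lt with e | hl
    · have := h.chord_nextPt h0.le hr x
      rw [← e] at this
      linarith [hm.2]
    · have := lt_of_lt_nextPt (hx.le.trans hm.1) hl
      linarith [hm.2]
  have hint : ∀ j : ℤ, nextPt D r j = nextPt D r 0 + j := fun j => by
    rw [← h.nextPt_add_int hr, zero_add]
  intro x x' hx
  rcases le_or_gt x' (⌊x⌋ + 1) with h1 | h1
  · exact edge ⌊x⌋ x x' (Int.floor_le x) hx h1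
  · have hfl : ⌊x⌋ + 1 ≤ ⌊x'⌋ := Int.le_floor.2 (by push_cast; exact h1.le)
    have a := edge ⌊x⌋ x (⌊x⌋ + 1) (Int.floor_le x) (Int.lt_floor_add_one x) le_rfl
    have b : nextPt D r ((⌊x⌋ + 1 : ℤ) : ℝ) ≤ nextPt D r (⌊x'⌋ : ℝ) := by
      rw [hint, hint]
      have : ((⌊x⌋ + 1 : ℤ) : ℝ) ≤ (⌊x'⌋ : ℝ) := by exact_mod_cast hfl
      linarith
    have c : nextPt D r (⌊x'⌋ : ℝ) ≤ nextPt D r x' := by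
      rcases (Int.floor_le x').eq_or_lt with e | hl
      · exact (congrArg _ e).le
      · exact (edge ⌊x'⌋ _ x' le_rfl hl (Int.lt_floor_add_one x').le).le
    push_cast at b
    linarith

theorem nextPt_le_nextPt (h : IsChordFun D β R) (hrr : r ≤ r') (hr : r' ≤ R) (x : ℝ) :
    nextPt D r x ≤ nextPt D r' x :=
  nextPt_le (h.le_nextPt hr x) (hrr.trans (h.nextPt_mem hr x).2)

theorem nextPt_lt_nextPt (h : IsChordFun D β R) (h0 : 0 ≤ r) (hrr : r < r') (hr : r' ≤ R) (x : ℝ) :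
    nextPt D r x < nextPt D r' x := by
  refine lt_of_le_of_ne (h.nextPt_le_nextPt hrr.le hr x) fun e => ?_
  have h1 := h.chord_nextPt h0 (hrr.le.trans hr) x
  have h2 := h.chord_nextPt (h0.trans hrr.le) hr x
  rw [e] at h1
  linarith

theorem le_prevPt (h : IsChordFun D β R) (hxy : x ≤ y) (hr : r ≤ D x y) : x ≤ prevPt D r y :=
  le_neg_of_le_neg (nextPt_le (neg_le_neg hxy) (by rwa [h.reflect]))

theorem chord_prevPt (h : IsChordFun D β R) (h0 : 0 ≤ r) (hr : r ≤ R) (y : ℝ) :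
    D (prevPt D r y) y = r := by
  have := h.chord_nextPt h0 hr (-y)
  rwa [← h.reflect, neg_neg] at this

theorem prevPt_le (h : IsChordFun D β R) (hr : r ≤ R) (y : ℝ) : prevPt D r y ≤ y :=
  neg_le.1 (h.le_nextPt hr (-y))

theorem prevPt_nextPt (h : IsChordFun D β R) (h0 : 0 ≤ r) (hr : r ≤ R) (x : ℝ) :
    prevPt D r (nextPt D r x) = x := by
  refine le_antisymm ?_ (h.le_prevPt (h.le_nextPt hr x) (h.chord_nextPt h0 hr x).ge)
  rw [← (h.strictMono_nextPt hr).le_iff_le]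
  exact nextPt_le (h.prevPt_le hr _) (h.chord_prevPt h0 hr _).ge

theorem nextPt_prevPt (h : IsChordFun D β R) (h0 : 0 ≤ r) (hr : r ≤ R) (y : ℝ) :
    nextPt D r (prevPt D r y) = y := by
  have := h.prevPt_nextPt h0 hr (-y)
  unfold prevPt at this ⊢
  linarith

theorem exists_nextPt_lt (h : IsChordFun D β R) (h0 : 0 ≤ r) (hr : r < R)
    (hy : nextPt D r x < y) : ∃ r' x', r < r' ∧ r' ≤ R ∧ x < x' ∧ nextPt D r' x' < y := by
  have hfl := Int.floor_le x
  have hfl' := Int.lt_floor_add_one x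
  have hmono := h.strictMono_nextPt hr.le
  have h1 : nextPt D r x < ⌊x⌋ + β := by
    refine lt_of_le_of_ne (h.nextPt_le_level hr.le ⌊x⌋ hfl hfl'.le) fun e => ?_
    have h2 := h.chord_nextPt h0 hr.le x
    have h3 := h.le_level ⌊x⌋ hfl hfl'.le
    rw [e] at h2
    linarith
  obtain ⟨z, hz, hz'⟩ := exists_between (lt_min hy (lt_min (hmono hfl') h1))
  obtain ⟨hzy, hz'⟩ := lt_min_iff.1 hz'
  obtain ⟨hzj, hzb⟩ := lt_min_iff.1 hz'
  have e := h.nextPt_prevPt h0 hr.le z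
  have hx1 : x < prevPt D r z := hmono.lt_iff_lt.1 (by rwa [e])
  have hx2 : prevPt D r z < ⌊x⌋ + 1 := hmono.lt_iff_lt.1 (by rwa [e])
  have hpz := h.prevPt_le hr.le z
  have hlt := h.anti_int ⌊x⌋ (x := (x + prevPt D r z) / 2) (by linarith) (by linarith) hx2.le hpz
    hzb.le
  rw [h.chord_prevPt h0 hr.le] at hlt
  exact ⟨min R (D ((x + prevPt D r z) / 2) z), (x + prevPt D r z) / 2, lt_min hr hlt,
    min_le_left _ _, by linarith, lt_of_le_of_lt (nextPt_le (by linarith) (min_le_right _ _)) hzy⟩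

theorem iterate_le_iterate (h : IsChordFun D β R) (hrr : r ≤ r') (hr : r' ≤ R) (x : ℝ) (i : ℕ) :
    (nextPt D r)^[i] x ≤ (nextPt D r')^[i] x := by
  induction i with
  | zero => exact le_rfl
  | succ i ih =>
    rw [Function.iterate_succ_apply', Function.iterate_succ_apply']
    exact (h.nextPt_le_nextPt hrr hr _).trans ((h.strictMono_nextPt hr).monotone ih)

theorem iterate_lt_iterate (h : IsChordFun D β R) (h0 : 0 ≤ r) (hrr : r < r') (hr : r' ≤ R) (x : ℝ)
    {m : ℕ} (hm : m ≠ 0) : (nextPt D r)^[m] x < (nextPt D r')^[m] x := by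
  obtain ⟨i, rfl⟩ := Nat.exists_eq_succ_of_ne_zero hm
  rw [Nat.succ_eq_add_one, Function.iterate_succ_apply', Function.iterate_succ_apply']
  exact (h.nextPt_lt_nextPt h0 hrr hr _).trans_le
    ((h.strictMono_nextPt hr).monotone (h.iterate_le_iterate hrr.le hr x i))

theorem exists_iterate_lt (h : IsChordFun D β R) (h0 : 0 ≤ r) (hr : r < R) (x : ℝ) (i : ℕ) :
    ∀ y, (nextPt D r)^[i] x < y → ∃ r', r < r' ∧ r' ≤ R ∧ (nextPt D r')^[i] x < y := by
  induction i with
  | zero => exact fun y hy => ⟨R, hr, le_rfl, hy⟩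
  | succ i ih =>
    intro y hy
    rw [Function.iterate_succ_apply'] at hy
    obtain ⟨r₁, x₁, h1, h2, h3, h4⟩ := h.exists_nextPt_lt h0 hr hy
    obtain ⟨r₂, h5, h6, h7⟩ := ih x₁ h3
    refine ⟨min r₁ r₂, lt_min h1 h5, (min_le_left _ _).trans h2, ?_⟩
    rw [Function.iterate_succ_apply']
    refine lt_of_le_of_lt (h.nextPt_le_nextPt (min_le_left _ _) h2 _) (lt_of_le_of_lt ?_ h4)
    refine (h.strictMono_nextPt h2).monotone ?_
    exact (h.iterate_le_iterate (min_le_right _ _) h6 x i).trans h7.le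

theorem iterate_le_of_forall_lt (h : IsChordFun D β R) (hr : r ≤ R) (x : ℝ) (m : ℕ)
    (hy : ∀ r' < r, (nextPt D r')^[m] x ≤ y) : (nextPt D r)^[m] x ≤ y := by
  have hmono : ∀ i, MonotoneOn (fun r' => (nextPt D r')^[i] x) (Set.Iio r) :=
    fun i r₁ _ r₂ h2 h12 => h.iterate_le_iterate h12 ((Set.mem_Iio.1 h2).le.trans hr) x i
  have hbdd : ∀ i, BddAbove ((fun r' => (nextPt D r')^[i] x) '' Set.Iio r) := by
    rintro i
    refine ⟨(nextPt D r)^[i] x, ?_⟩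
    rintro _ ⟨r', h', rfl⟩
    exact h.iterate_le_iterate (Set.mem_Iio.1 h').le hr x i
  have hlim := fun i => (hmono i).tendsto_nhdsLT (hbdd i)
  set L : ℕ → ℝ := fun i => sSup ((fun r' => (nextPt D r')^[i] x) '' Set.Iio r)
  have hL : ∀ i, (nextPt D r)^[i] x ≤ L i := by
    intro i
    induction i with
    | zero => exact (tendsto_nhds_unique (hlim 0) tendsto_const_nhds).ge
    | succ i ih =>
      rw [Function.iterate_succ_apply']
      refine ((h.strictMono_nextPt hr).monotone ih).trans (nextPt_le ?_ ?_)
      · refine le_of_tendsto_of_tendsto (hlim i) (hlim (i + 1)) ?_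
        filter_upwards [self_mem_nhdsWithin] with r' h'
        rw [Function.iterate_succ_apply']
        exact h.le_nextPt ((Set.mem_Iio.1 h').le.trans hr) _
      · have hid : Filter.Tendsto (fun r' : ℝ => r') (nhdsWithin r (Set.Iio r)) (nhds r) :=
          Filter.tendsto_id.mono_left nhdsWithin_le_nhds
        refine le_of_tendsto_of_tendsto hid
          ((h.cont.tendsto (L i, L (i + 1))).comp ((hlim i).prodMk_nhds (hlim (i + 1)))) ?_
        filter_upwards [self_mem_nhdsWithin] with r' h'
        simp only [Function.comp, Function.iterate_succ_apply']
        exact (h.nextPt_mem ((Set.mem_Iio.1 h').le.trans hr) _).2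
  refine (hL m).trans (le_of_tendsto (hlim m) ?_)
  filter_upwards [self_mem_nhdsWithin] with r' h'
  exact hy r' h'

theorem exists_iterate_eq (h : IsChordFun D β R) (x : ℝ) (m : ℕ) (hxy : x < y)
    (hy : y ≤ (nextPt D R)^[m] x) : ∃ r, 0 < r ∧ r ≤ R ∧ (nextPt D r)^[m] x = y := by
  set T : Set ℝ := {r | r ≤ R ∧ (nextPt D r)^[m] x ≤ y} with hT
  have hzero : (nextPt D 0)^[m] x = x :=
    Function.iterate_fixed (h.nextPt_of_nonpos le_rfl x) m
  have h0 : (0 : ℝ) ∈ T := ⟨h.pos.le, hzero.trans_le hxy.le⟩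
  have hbdd : BddAbove T := ⟨R, fun r hr => hr.1⟩
  have hsR : sSup T ≤ R := csSup_le ⟨0, h0⟩ fun r hr => hr.1
  have hs0 : 0 ≤ sSup T := le_csSup hbdd h0
  have hle : (nextPt D (sSup T))^[m] x ≤ y := by
    refine h.iterate_le_of_forall_lt hsR x m fun r' h' => ?_
    obtain ⟨r₁, h1, h2⟩ := exists_lt_of_lt_csSup ⟨0, h0⟩ h'
    exact (h.iterate_le_iterate h2.le h1.1 x m).trans h1.2
  have heq : (nextPt D (sSup T))^[m] x = y := by
    rcases hsR.eq_or_lt with e | hlt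
    · exact le_antisymm hle (by rwa [e])
    · refine hle.eq_of_not_lt fun hlt' => ?_
      obtain ⟨r', h1, h2, h3⟩ := h.exists_iterate_lt hs0 hlt x m y hlt'
      exact absurd (le_csSup hbdd ⟨h2, h3.le⟩) h1.not_ge
  refine ⟨sSup T, hs0.lt_of_ne fun e => ?_, hsR, heq⟩
  rw [← e, hzero] at heq
  exact hxy.ne heq

theorem add_le_nextPt (h : IsChordFun D β R) (x : ℝ) {t : ℝ} (ht : t ≤ β - 1) :
    x + t ≤ nextPt D R x := by
  by_contra! hlt
  have hm := h.nextPt_mem le_rfl x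
  have h1 := h.le_zero x (nextPt D R x - x) (by linarith [hm.1])
  rw [add_sub_cancel, ← h.reflect 0, neg_zero] at h1
  have hfl := Int.lt_floor_add_one (-(β - 1))
  have h2 := h.anti (x := -(β - 1)) (x' := -(nextPt D R x - x)) (z := 0) (by linarith)
    (by linarith [hm.1]) (by linarith)
  have h3 : D (-(β - 1)) 0 = R := by
    have := h.reflect 0 (β - 1)
    rw [neg_zero] at this
    rw [this, ← h.shift, zero_add, sub_add_cancel, h.at_level]
  linarith [hm.2]

theorem add_le_iterate (h : IsChordFun D β R) (x : ℝ) {t : ℝ} (ht : t ≤ β - 1) (i : ℕ) :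
    x + i * t ≤ (nextPt D R)^[i] x := by
  induction i with
  | zero => simp
  | succ i ih =>
    rw [Function.iterate_succ_apply']
    have := h.add_le_nextPt ((nextPt D R)^[i] x) ht
    push_cast
    linarith

theorem iterate_add_int (h : IsChordFun D β R) (hr : r ≤ R) (x : ℝ) (j : ℤ) (i : ℕ) :
    (nextPt D r)^[i] (x + j) = (nextPt D r)^[i] x + j := by
  induction i with
  | zero => rfl
  | succ i ih =>
    rw [Function.iterate_succ_apply', Function.iterate_succ_apply', ih, h.nextPt_add_int hr]

theorem existsUnique_iterate_eq (h : IsChordFun D β R) (x : ℝ) {m : ℕ} {T : ℝ} (hm : m ≠ 0)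
    (hT : 0 < T) (hTm : T ≤ m * (β - 1)) :
    ∃! r, 0 < r ∧ r ≤ R ∧ (nextPt D r)^[m] x = x + T := by
  obtain ⟨r, h0, hr, he⟩ := h.exists_iterate_eq x m (y := x + T) (by linarith)
    (by linarith [h.add_le_iterate x le_rfl m])
  refine ⟨r, ⟨h0, hr, he⟩, ?_⟩
  rintro r' ⟨h0', hr', he'⟩
  rcases lt_trichotomy r r' with hlt | rfl | hlt
  · linarith [h.iterate_lt_iterate h0.le hlt hr' x hm]
  · rfl
  · linarith [h.iterate_lt_iterate h0'.le hlt hr x hm]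

end IsChordFun

theorem iterate_coprime_period {F : ℝ → ℝ} (hmono : StrictMono F)
    (hint : ∀ (x : ℝ) (j : ℤ), F (x + j) = F x + j) {c : ℝ} {g q : ℕ} {M : ℤ} (hg : 0 < g)
    (he : F^[q * g] c = c + g * M) : F^[q] c = c + M := by
  have hcomm : Function.Commute F (fun x => x + (M : ℝ)) := fun x => hint x M
  have hadd : StrictMono fun x : ℝ => x + (M : ℝ) := fun a b hab => by simpa using hab
  have key := (hcomm.iterate_left q).iterate_pos_eq_iff_map_eq (x := c)
    (hmono.iterate q).monotone hadd hg
  refine key.1 ?_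
  rw [← Function.iterate_mul, he, add_right_iterate, nsmul_eq_mul]

theorem iterate_mul_period {F : ℝ → ℝ} {q : ℕ} {M : ℤ} {y : ℝ}
    (hint : ∀ (x : ℝ) (j : ℤ), F (x + j) = F x + j) (hq : F^[q] y = y + M) (a : ℕ) :
    F^[q * a] y = y + a * M := by
  have hint' : ∀ (i : ℕ) (x : ℝ) (j : ℤ), F^[i] (x + j) = F^[i] x + j := by
    intro i
    induction i with
    | zero => exact fun _ _ => rfl
    | succ i ih =>
      intro x j
      rw [Function.iterate_succ_apply, hint, ih, Function.iterate_succ_apply]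
  induction a with
  | zero => simp
  | succ a ih =>
    rw [mul_add, mul_one, add_comm, Function.iterate_add_apply, ih]
    have := hint' q y (a * M)
    push_cast at this ⊢
    rw [this, hq]
    ring

theorem dvd_of_iterate_eq_add_int {F : ℝ → ℝ}
    (hint : ∀ (x : ℝ) (j : ℤ), F (x + j) = F x + j) {y : ℝ} {q d : ℕ} {M k : ℤ}
    (hq : F^[q] y = y + M) (hd : F^[d] y = y + k) (hcop : IsCoprime (q : ℤ) M) : q ∣ d := by
  have h1 := iterate_mul_period hint hq d
  have h2 := iterate_mul_period hint hd q
  rw [mul_comm, h2] at h1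
  have h3 : (q : ℤ) * k = d * M := by
    have : (q : ℝ) * k = d * M := by linarith
    exact_mod_cast this
  exact Int.natCast_dvd_natCast.1 (hcop.dvd_of_dvd_mul_right (Dvd.intro _ h3))

/-- If `F` is the lift of a circle map commuting with unit translations, and `c` is periodic with
`2 * l + 1` steps covering `l` turns of length `n`, then the integer translates of the orbit of `c`
form `lcm n (2 * l + 1)` points modulo `n`. -/
theorem orbit_ncard {F : ℝ → ℝ} (hmono : StrictMono F)
    (hint : ∀ (x : ℝ) (j : ℤ), F (x + j) = F x + j) {c : ℝ} {l n : ℕ} (hn : 0 < n)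
    (he : F^[2 * l + 1] c = c + l * n) {γ : ℝ → ℂ}
    (hγ : ∀ s s', γ s = γ s' ↔ ∃ k : ℤ, s' = s + k * n) :
    {p | ∃ (i : ℕ) (j : ℤ), p = γ (F^[i] c + j)}.Finite ∧
      {p | ∃ (i : ℕ) (j : ℤ), p = γ (F^[i] c + j)}.ncard = Nat.lcm n (2 * l + 1) := by
  obtain ⟨n', hn'⟩ := Nat.gcd_dvd_left n (2 * l + 1)
  obtain ⟨q, hq⟩ := Nat.gcd_dvd_right n (2 * l + 1)
  set g := Nat.gcd n (2 * l + 1) with hgdef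
  have hg : 0 < g := Nat.gcd_pos_of_pos_left _ hn
  have hq0 : 0 < q := Nat.pos_of_ne_zero fun e => by simp [e] at hq
  have hcop : IsCoprime (q : ℤ) ((l * n' : ℕ) : ℤ) := by
    rw [Nat.isCoprime_iff_coprime]
    refine Nat.Coprime.mul_right ?_ ?_
    · have h1 : Nat.Coprime (2 * l + 1) l := by simp [Nat.coprime_mul_right_add_left]
      exact Nat.Coprime.coprime_dvd_left ⟨g, by rw [hq, mul_comm]⟩ h1
    · have h1 : n / g = n' := Nat.div_eq_of_eq_mul_right hg hn'
      have h2 : (2 * l + 1) / g = q := Nat.div_eq_of_eq_mul_right hg hq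
      rw [← h1, ← h2]
      exact (Nat.coprime_div_gcd_div_gcd hg).symm
  have hper : F^[q] c = c + ((l * n' : ℕ) : ℤ) := by
    refine iterate_coprime_period hmono hint hg ?_
    rw [mul_comm, ← hq, he]
    nth_rewrite 1 [hn']
    push_cast
    ring
  have hint' : ∀ (i : ℕ) (x : ℝ) (j : ℤ), F^[i] (x + j) = F^[i] x + j := by
    intro i
    induction i with
    | zero => exact fun _ _ => rfl
    | succ i ih =>
      intro x j
      rw [Function.iterate_succ_apply, hint, ih, Function.iterate_succ_apply]
  have hset : {p | ∃ (i : ℕ) (j : ℤ), p = γ (F^[i] c + j)} =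
      (fun x : ℕ × ℕ => γ (F^[x.1] c + x.2)) ''
        (Finset.range q ×ˢ Finset.range n : Finset (ℕ × ℕ)) := by
    ext p
    simp only [Set.mem_ofPred_eq, Set.mem_image, Finset.coe_product, Set.mem_prod, Finset.mem_coe,
      Finset.mem_range, Prod.exists]
    constructor
    · rintro ⟨i, j, rfl⟩
      have h1 : F^[i] c = F^[i % q] c + ((i / q : ℕ) * (l * n' : ℕ) : ℤ) := by
        conv_lhs => rw [← Nat.mod_add_div i q, Function.iterate_add_apply,
          iterate_mul_period hint hper]
        rw [← hint']
        push_cast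
        rfl
      set K : ℤ := ((i / q : ℕ) * (l * n' : ℕ) : ℤ)
      have hn0 : (0 : ℤ) < n := by exact_mod_cast hn
      refine ⟨i % q, ((K + j) % n).toNat, ⟨Nat.mod_lt _ hq0, ?_⟩, ?_⟩
      · have := Int.emod_lt_of_pos (K + j) hn0
        omega
      · rw [h1, hγ]
        refine ⟨(K + j) / n, ?_⟩
        have h2 : (((K + j) % n).toNat : ℤ) = (K + j) % n :=
          Int.toNat_of_nonneg (Int.emod_nonneg _ hn0.ne')
        have h3 : (((K + j) % n).toNat : ℝ) = (((K + j) % n : ℤ) : ℝ) := by exact_mod_cast h2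
        have h4 : (((K + j) % n : ℤ) : ℝ) + n * (((K + j) / n : ℤ) : ℝ) = K + j := by
          exact_mod_cast Int.emod_add_mul_ediv (K + j) n
        rw [h3]
        linarith
    · rintro ⟨i, j, -, rfl⟩
      exact ⟨i, j, by push_cast; rfl⟩
  have hle : ∀ i i' : ℕ, i ≤ i' → i' < q → ∀ k : ℤ, F^[i'] c = F^[i] c + k → i = i' := by
    intro i i' hii hi' k hk
    have hy : F^[q] (F^[i] c) = F^[i] c + ((l * n' : ℕ) : ℤ) := by
      rw [← Function.iterate_add_apply, add_comm, Function.iterate_add_apply, hper, hint']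
    have hd : F^[i' - i] (F^[i] c) = F^[i] c + k := by
      rw [← Function.iterate_add_apply, Nat.sub_add_cancel hii, hk]
    have := Nat.eq_zero_of_dvd_of_lt (dvd_of_iterate_eq_add_int hint hy hd hcop) (by omega)
    omega
  have hinj : Set.InjOn (fun x : ℕ × ℕ => γ (F^[x.1] c + x.2))
      (Finset.range q ×ˢ Finset.range n : Finset (ℕ × ℕ)) := by
    rintro ⟨i, j⟩ hx ⟨i', j'⟩ hx' heq
    simp only [Finset.coe_product, Set.mem_prod, Finset.mem_coe, Finset.mem_range] at hx hx'
    obtain ⟨k, hk⟩ := (hγ _ _).1 heq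
    have hii : i = i' := by
      rcases le_total i i' with hl | hl
      · exact hle i i' hl hx'.1 (j + k * n - j') (by push_cast; linarith)
      · exact (hle i' i hl hx.1 (j' - k * n - j) (by push_cast; linarith)).symm
    subst hii
    have h1 : (j' : ℤ) = j + k * n := by
      have : (j' : ℝ) = j + k * n := by linarith
      exact_mod_cast this
    have h2 : j ≡ j' [MOD n] := by
      rw [← Int.natCast_modEq_iff, h1]
      exact (Int.modEq_iff_dvd.2 ⟨k, by ring⟩)
    rw [Nat.ModEq, Nat.mod_eq_of_lt hx.2, Nat.mod_eq_of_lt hx'.2] at h2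
    rw [h2]
  rw [hset]
  refine ⟨(Finset.finite_toSet _).image _, ?_⟩
  rw [hinj.ncard_image, Set.ncard_coe_finset, Finset.card_product, Finset.card_range,
    Finset.card_range, Nat.lcm, ← hgdef]
  refine (Nat.div_eq_of_eq_mul_right hg ?_).symm
  rw [hq]
  ring

/-- The parametrization of the polygon `P_n` by edge units: `edgeParam n s` traverses an edge as `s`
runs through a unit interval between consecutive integers. -/
noncomputable def edgeParam (n : ℕ) (s : ℝ) : ℂ :=
  ((1 - Int.fract s : ℝ) : ℂ) * (nroot n) ^ ⌊s⌋ + ((Int.fract s : ℝ) : ℂ) * (nroot n) ^ (⌊s⌋ + 1)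

theorem polyParam_eq_edgeParam (n : ℕ) (t : ℝ) : polyParam n t = edgeParam n (n * t) := rfl

theorem nroot_ne_zero (n : ℕ) : nroot n ≠ 0 := Complex.exp_ne_zero _

theorem nroot_zpow (n : ℕ) (k : ℤ) :
    nroot n ^ k = Complex.exp ((2 * k * (Real.pi / n) : ℝ) * Complex.I) := by
  rw [nroot, ← Complex.exp_int_mul]
  congr 1
  push_cast
  ring

theorem norm_nroot_zpow (n : ℕ) (k : ℤ) : ‖nroot n ^ k‖ = 1 := by
  rw [nroot_zpow, Complex.norm_exp_ofReal_mul_I]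

theorem nroot_zpow_mul_self {n : ℕ} (hn : n ≠ 0) (k : ℤ) : nroot n ^ (k * n) = 1 := by
  rw [nroot_zpow, Complex.exp_eq_one_iff]
  refine ⟨k, ?_⟩
  have : (n : ℂ) ≠ 0 := by exact_mod_cast hn
  push_cast
  field_simp

theorem conj_nroot_zpow (n : ℕ) (k : ℤ) :
    (starRingEnd ℂ) (nroot n ^ k) = nroot n ^ (-k) := by
  rw [nroot_zpow, nroot_zpow, ← Complex.exp_conj]
  congr 1
  simp only [map_mul, Complex.conj_ofReal, Complex.conj_I]
  push_cast
  ring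

theorem edgeParam_int_add (n : ℕ) (k : ℤ) {f : ℝ} (h0 : 0 ≤ f) (h1 : f ≤ 1) :
    edgeParam n (k + f) = (1 - f : ℝ) * nroot n ^ k + f * nroot n ^ (k + 1) := by
  rcases h1.eq_or_lt with rfl | h1
  · have : (k : ℝ) + 1 = ((k + 1 : ℤ) : ℝ) := by push_cast; rfl
    rw [edgeParam, this]
    simp
  · have hf : ⌊(k : ℝ) + f⌋ = k := by
      rw [Int.floor_intCast_add, Int.floor_eq_zero_iff.2 ⟨h0, h1⟩, add_zero]
    have hf' : Int.fract ((k : ℝ) + f) = f := by rw [Int.fract, hf]; ring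
    rw [edgeParam, hf, hf']

theorem edgeParam_add_int (n : ℕ) (s : ℝ) (j : ℤ) :
    edgeParam n (s + j) = nroot n ^ j * edgeParam n s := by
  simp only [edgeParam, Int.fract_add_intCast, Int.floor_add_intCast]
  rw [add_right_comm ⌊s⌋ j 1, zpow_add₀ (nroot_ne_zero n), zpow_add₀ (nroot_ne_zero n) (⌊s⌋ + 1)]
  ring

theorem edgeParam_intCast (n : ℕ) (j : ℤ) : edgeParam n j = nroot n ^ j := by
  simp [edgeParam]

theorem edgeParam_neg (n : ℕ) (s : ℝ) :
    edgeParam n (-s) = (starRingEnd ℂ) (edgeParam n s) := by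
  have h0 := Int.fract_nonneg s
  have h1 := (Int.fract_lt_one s).le
  have h2 := Int.floor_add_fract s
  have e : -s = ((-⌊s⌋ - 1 : ℤ) : ℝ) + (1 - Int.fract s) := by push_cast; linarith
  rw [e, edgeParam_int_add n _ (by linarith) (by linarith), edgeParam, map_add, map_mul, map_mul,
    Complex.conj_ofReal, Complex.conj_ofReal, conj_nroot_zpow, conj_nroot_zpow, sub_add_cancel,
    neg_add, ← sub_eq_add_neg]
  push_cast
  ring

theorem continuous_edgeParam {n : ℕ} : Continuous (edgeParam n) := by
  let f : ℝ → ℝ → ℂ := fun s u =>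
    Complex.exp ((2 * (s - u) * (Real.pi / n) : ℝ) * Complex.I) * (1 + u * (nroot n - 1))
  have h : edgeParam n = fun s => f s (Int.fract s) := by
    funext s
    simp only [f, Int.self_sub_fract]
    rw [← nroot_zpow, edgeParam, zpow_add_one₀ (nroot_ne_zero n)]
    push_cast
    ring
  have hc : Continuous (Function.uncurry f) := by
    simp only [f, Function.uncurry_def]
    fun_prop
  rw [h]
  refine ContinuousOn.comp_fract (f := f) (s := fun s : ℝ => s) hc.continuousOn continuous_id
    fun s => ?_
  have e : (nroot n : ℂ) = Complex.exp ((2 * (Real.pi / n) : ℝ) * Complex.I) := by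
    simpa using nroot_zpow n 1
  simp only [f, Complex.ofReal_zero, zero_mul, add_zero, mul_one, Complex.ofReal_one, one_mul,
    add_sub_cancel]
  rw [e, ← Complex.exp_add]
  congr 1
  push_cast
  ring

theorem dist_edgeParam_add_int (n : ℕ) (x y : ℝ) (j : ℤ) :
    dist (edgeParam n (x + j)) (edgeParam n (y + j)) = dist (edgeParam n x) (edgeParam n y) := by
  rw [edgeParam_add_int, edgeParam_add_int, dist_eq_norm, dist_eq_norm, ← mul_sub, norm_mul,
    norm_nroot_zpow, one_mul]

theorem dist_edgeParam_neg (n : ℕ) (x y : ℝ) :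
    dist (edgeParam n (-y)) (edgeParam n (-x)) = dist (edgeParam n x) (edgeParam n y) := by
  rw [edgeParam_neg, edgeParam_neg, dist_eq_norm, dist_eq_norm, ← map_sub, Complex.norm_conj,
    norm_sub_rev]

/-- The component of `edgeParam n s` normal to the edge from `1` to `ω`. -/
noncomputable def normalCoord (n : ℕ) (s : ℝ) : ℝ :=
  (edgeParam n s * Complex.exp ((-(Real.pi / n) : ℝ) * Complex.I)).re

/-- The component of `edgeParam n s` along the edge from `1` to `ω`. -/
noncomputable def tangentCoord (n : ℕ) (s : ℝ) : ℝ :=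
  (edgeParam n s * Complex.exp ((-(Real.pi / n) : ℝ) * Complex.I)).im

theorem dist_edgeParam_sq (n : ℕ) (x y : ℝ) :
    dist (edgeParam n x) (edgeParam n y) ^ 2 =
      (normalCoord n x - normalCoord n y) ^ 2 + (tangentCoord n x - tangentCoord n y) ^ 2 := by
  have h : dist (edgeParam n x) (edgeParam n y) =
      ‖edgeParam n x * Complex.exp ((-(Real.pi / n) : ℝ) * Complex.I) -
        edgeParam n y * Complex.exp ((-(Real.pi / n) : ℝ) * Complex.I)‖ := by
    rw [dist_eq_norm, ← sub_mul, norm_mul, Complex.norm_exp_ofReal_mul_I, mul_one]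
  rw [h, Complex.sq_norm, Complex.normSq_apply, Complex.sub_re, Complex.sub_im, normalCoord,
    normalCoord, tangentCoord, tangentCoord]
  ring

theorem edgeParam_mul_exp (n : ℕ) (k : ℤ) {f : ℝ} (h0 : 0 ≤ f) (h1 : f ≤ 1) :
    edgeParam n (k + f) * Complex.exp ((-(Real.pi / n) : ℝ) * Complex.I) =
      (1 - f : ℝ) * Complex.exp (((2 * k - 1) * (Real.pi / n) : ℝ) * Complex.I) +
        f * Complex.exp (((2 * k + 1) * (Real.pi / n) : ℝ) * Complex.I) := by
  have e : ∀ j : ℤ, nroot n ^ j * Complex.exp ((-(Real.pi / n) : ℝ) * Complex.I) =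
      Complex.exp (((2 * j - 1) * (Real.pi / n) : ℝ) * Complex.I) := fun j => by
    rw [nroot_zpow, ← Complex.exp_add]
    congr 1
    push_cast
    ring
  rw [edgeParam_int_add n k h0 h1, add_mul, mul_assoc, mul_assoc, e, e]
  congr 5
  push_cast
  ring

theorem normalCoord_int_add (n : ℕ) (k : ℤ) {f : ℝ} (h0 : 0 ≤ f) (h1 : f ≤ 1) :
    normalCoord n (k + f) = (1 - f) * Real.cos ((2 * k - 1) * (Real.pi / n)) +
      f * Real.cos ((2 * k + 1) * (Real.pi / n)) := by
  rw [normalCoord, edgeParam_mul_exp n k h0 h1, Complex.add_re, Complex.re_ofReal_mul,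
    Complex.re_ofReal_mul, Complex.exp_ofReal_mul_I_re, Complex.exp_ofReal_mul_I_re]

theorem tangentCoord_int_add (n : ℕ) (k : ℤ) {f : ℝ} (h0 : 0 ≤ f) (h1 : f ≤ 1) :
    tangentCoord n (k + f) = (1 - f) * Real.sin ((2 * k - 1) * (Real.pi / n)) +
      f * Real.sin ((2 * k + 1) * (Real.pi / n)) := by
  rw [tangentCoord, edgeParam_mul_exp n k h0 h1, Complex.add_im, Complex.im_ofReal_mul,
    Complex.im_ofReal_mul, Complex.exp_ofReal_mul_I_im, Complex.exp_ofReal_mul_I_im]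

theorem normalCoord_of_mem (n : ℕ) {x : ℝ} (h0 : 0 ≤ x) (h1 : x ≤ 1) :
    normalCoord n x = Real.cos (Real.pi / n) := by
  have := normalCoord_int_add n 0 h0 h1
  simp only [Int.cast_zero, zero_add, mul_zero, zero_sub, neg_mul, one_mul, Real.cos_neg] at this
  rw [this]
  ring

theorem tangentCoord_of_mem (n : ℕ) {x : ℝ} (h0 : 0 ≤ x) (h1 : x ≤ 1) :
    tangentCoord n x = (2 * x - 1) * Real.sin (Real.pi / n) := by
  have := tangentCoord_int_add n 0 h0 h1
  simp only [Int.cast_zero, zero_add, mul_zero, zero_sub, neg_mul, one_mul, Real.sin_neg] at this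
  rw [this]
  ring

theorem sin_le_sin_of_le_of_le_pi_sub {a b : ℝ} (hb : 0 ≤ b) (h1 : b ≤ a) (h2 : a ≤ Real.pi - b) :
    Real.sin b ≤ Real.sin a := by
  have h3 := Real.sin_sub_sin a b
  have h4 : 0 ≤ Real.sin ((a - b) / 2) :=
    Real.sin_nonneg_of_nonneg_of_le_pi (by linarith) (by linarith)
  have h5 : 0 ≤ Real.cos ((a + b) / 2) :=
    Real.cos_nonneg_of_neg_pi_div_two_le_of_le (by linarith [Real.pi_pos]) (by linarith)
  nlinarith [mul_nonneg h4 h5]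

theorem cos_lt_cos_of_lt_of_lt_two_pi_sub {a b : ℝ} (hb : 0 ≤ b) (h1 : b < a)
    (h2 : a < 2 * Real.pi - b) : Real.cos a < Real.cos b := by
  have h3 := Real.cos_sub_cos a b
  have h4 : 0 < Real.sin ((a + b) / 2) := Real.sin_pos_of_pos_of_lt_pi (by linarith) (by linarith)
  have h5 : 0 < Real.sin ((a - b) / 2) := Real.sin_pos_of_pos_of_lt_pi (by linarith) (by linarith)
  nlinarith [mul_pos h4 h5]

/-- The parameter of the point at distance `rpoly n` from `ω` in the direction normal to the edge
from `1` to `ω`. -/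
noncomputable def polyLevel (n : ℕ) : ℝ :=
  if Even n then n / 2 else (n + 1) / 2 - 1 / (2 * Real.cos (Real.pi / n))

theorem cos_pi_div_bound {n : ℕ} (hn : 6 ≤ n) :
    ((n : ℝ) - 1) / (n + 1) ≤ Real.cos (Real.pi / n) := by
  have hn' : (6 : ℝ) ≤ n := by exact_mod_cast hn
  refine le_trans ?_ (Real.one_sub_sq_div_two_le_cos (x := Real.pi / n))
  have hpi : Real.pi ^ 2 ≤ 10 := by nlinarith [Real.pi_lt_d2, Real.pi_pos]
  rw [div_pow, div_le_iff₀ (by linarith)]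
  have h1 : Real.pi ^ 2 / (n : ℝ) ^ 2 ≤ 10 / (n : ℝ) ^ 2 := by gcongr
  have h2 : 10 / (n : ℝ) ^ 2 * (n + 1) ≤ 4 := by
    rw [div_mul_eq_mul_div, div_le_iff₀ (by positivity)]
    nlinarith
  nlinarith

theorem half_lt_cos_pi_div {n : ℕ} (hn : 6 ≤ n) : 1 / 2 < Real.cos (Real.pi / n) := by
  have hn' : (6 : ℝ) ≤ n := by exact_mod_cast hn
  refine lt_of_lt_of_le ?_ (cos_pi_div_bound hn)
  rw [div_lt_div_iff₀ (by norm_num) (by linarith)]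
  linarith

theorem sin_pi_div_pos {n : ℕ} (hn : 6 ≤ n) : 0 < Real.sin (Real.pi / n) := by
  have hn' : (6 : ℝ) ≤ n := by exact_mod_cast hn
  exact Real.sin_pos_of_pos_of_lt_pi (by positivity) (div_lt_self Real.pi_pos (by linarith))

theorem inv_two_cos_mem {n : ℕ} (hn : 6 ≤ n) :
    0 < 1 / (2 * Real.cos (Real.pi / n)) ∧ 1 / (2 * Real.cos (Real.pi / n)) < 1 := by
  have := half_lt_cos_pi_div hn
  refine ⟨by positivity, ?_⟩
  rw [div_lt_one (by linarith)]
  linarith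

theorem one_le_polyLevel {n : ℕ} (hn : 6 ≤ n) : 1 ≤ polyLevel n := by
  have hn' : (6 : ℝ) ≤ n := by exact_mod_cast hn
  have := inv_two_cos_mem hn
  unfold polyLevel
  split_ifs <;> linarith

theorem polyLevel_lt {n : ℕ} (hn : 6 ≤ n) : polyLevel n < n := by
  have hn' : (6 : ℝ) ≤ n := by exact_mod_cast hn
  have := inv_two_cos_mem hn
  unfold polyLevel
  split_ifs <;> linarith

theorem mul_le_mul_polyLevel {l n : ℕ} (hl : 1 ≤ l) (hn : 4 * l + 2 ≤ n) :
    (l * n : ℝ) ≤ ((2 * l + 1 : ℕ) : ℝ) * (polyLevel n - 1) := by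
  unfold polyLevel
  have hn' : (4 * l + 2 : ℝ) ≤ n := by exact_mod_cast hn
  push_cast
  split_ifs with he
  · linarith
  · have hodd : (4 * l + 3 : ℝ) ≤ n := by
      have : 4 * l + 3 ≤ n := by
        rw [Nat.not_even_iff_odd] at he
        obtain ⟨h, rfl⟩ := he
        omega
      exact_mod_cast this
    have hl' : (1 : ℝ) ≤ l := by exact_mod_cast hl
    have hc := cos_pi_div_bound (n := n) (by omega)
    have h0 := half_lt_cos_pi_div (n := n) (by omega)
    have h1 : 1 / (2 * Real.cos (Real.pi / n)) ≤ ((n : ℝ) + 1) / (2 * (n - 1)) := by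
      rw [div_le_div_iff₀ (by linarith) (by linarith)]
      rw [div_le_iff₀ (by linarith)] at hc
      nlinarith
    have h2 : (2 * l + 1 : ℝ) * (1 / (2 * Real.cos (Real.pi / n))) ≤
        ((n : ℝ) - 1) / 2 * ((n + 1) / (2 * (n - 1))) :=
      mul_le_mul (by linarith) h1 (inv_two_cos_mem (by omega)).1.le (by linarith)
    have h3 : ((n : ℝ) - 1) / 2 * ((n + 1) / (2 * (n - 1))) = (n + 1) / 4 := by
      have : (n : ℝ) - 1 ≠ 0 := by linarith
      field_simp
      ring
    nlinarith

theorem sin_le_tangentCoord {n : ℕ} (hn : 6 ≤ n) {z : ℝ} (h1 : 1 ≤ z) (hz : z ≤ polyLevel n) :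
    Real.sin (Real.pi / n) ≤ tangentCoord n z := by
  have hn' : (6 : ℝ) ≤ n := by exact_mod_cast hn
  have hn0 : (n : ℝ) ≠ 0 := by linarith
  set θ := Real.pi / n with hθ
  have hθ0 : 0 < θ := by positivity
  have hnθ : n * θ = Real.pi := by rw [hθ]; field_simp
  have hsin : ∀ k : ℤ, 1 ≤ k → 2 * k ≤ n → Real.sin θ ≤ Real.sin ((2 * k - 1) * θ) := by
    intro k hk hk'
    have a : (1 : ℝ) ≤ k := by exact_mod_cast hk
    have b : (2 * k : ℝ) ≤ n := by exact_mod_cast hk'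
    refine sin_le_sin_of_le_of_le_pi_sub hθ0.le (by nlinarith) ?_
    rw [← hnθ]
    nlinarith
  have hf0 := Int.fract_nonneg z
  have hf1 := Int.fract_lt_one z
  have hk1 : 1 ≤ ⌊z⌋ := Int.le_floor.2 (by simpa using h1)
  have hfl := Int.floor_le z
  rw [← Int.floor_add_fract z, tangentCoord_int_add n _ hf0 hf1.le]
  set f := Int.fract z with hf
  by_cases hc : 2 * (⌊z⌋ + 1) ≤ n
  · have a := hsin ⌊z⌋ hk1 (by omega)
    have b := hsin (⌊z⌋ + 1) (by omega) hc
    push_cast at b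
    rw [show (2 * ((⌊z⌋ : ℝ) + 1) - 1) = 2 * ⌊z⌋ + 1 by ring] at b
    nlinarith
  · have hz' : z = ⌊z⌋ + f := (Int.floor_add_fract z).symm
    unfold polyLevel at hz
    split_ifs at hz with he
    · obtain ⟨h, hh⟩ := he
      have e1 : (n : ℝ) = h + h := by exact_mod_cast hh
      have e2 : (⌊z⌋ : ℝ) ≤ (h : ℤ) := by push_cast; linarith
      have e3 : ⌊z⌋ ≤ h := by exact_mod_cast e2
      have e4 : ⌊z⌋ = h := by omega
      have e5 : (⌊z⌋ : ℝ) = h := by exact_mod_cast e4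
      have e6 : f = 0 := by linarith
      have a := hsin ⌊z⌋ hk1 (by omega)
      rw [e6]
      linarith
    · rw [Nat.not_even_iff_odd] at he
      obtain ⟨h, hh⟩ := he
      have hx := inv_two_cos_mem hn
      have hcos := half_lt_cos_pi_div hn
      have e1 : (n : ℝ) = 2 * h + 1 := by exact_mod_cast hh
      have e2 : (⌊z⌋ : ℝ) < ((h + 1 : ℤ) : ℝ) := by push_cast; linarith
      have e3 : ⌊z⌋ < h + 1 := by exact_mod_cast e2
      have e4 : ⌊z⌋ = h := by omega
      have e5 : (⌊z⌋ : ℝ) = h := by exact_mod_cast e4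
      have e6 : (2 * (⌊z⌋ : ℝ) - 1) * θ = Real.pi - 2 * θ := by rw [← hnθ, e5, e1]; ring
      have e7 : (2 * (⌊z⌋ : ℝ) + 1) * θ = Real.pi := by rw [← hnθ, e5, e1]
      rw [e6, e7, Real.sin_pi_sub, Real.sin_pi, Real.sin_two_mul]
      have e8 : 1 / (2 * Real.cos θ) ≤ 1 - f := by linarith
      rw [div_le_iff₀ (by linarith)] at e8
      nlinarith [sin_pi_div_pos hn]

theorem dist_edgeParam_lt {n : ℕ} (hn : 6 ≤ n) {x x' z : ℝ} (h0 : 0 ≤ x) (hx : x < x')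
    (h1 : x' ≤ 1) (hz : x' ≤ z) (hb : z ≤ polyLevel n) :
    dist (edgeParam n x') (edgeParam n z) < dist (edgeParam n x) (edgeParam n z) := by
  have hs := sin_pi_div_pos hn
  have ht : (2 * x' - 1) * Real.sin (Real.pi / n) ≤ tangentCoord n z := by
    rcases le_total z 1 with hz1 | hz1
    · rw [tangentCoord_of_mem n (by linarith) hz1]
      nlinarith
    · refine le_trans ?_ (sin_le_tangentCoord hn hz1 hb)
      nlinarith
  have hlt : (2 * x - 1) * Real.sin (Real.pi / n) < (2 * x' - 1) * Real.sin (Real.pi / n) := by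
    nlinarith
  refine lt_of_pow_lt_pow_left₀ 2 dist_nonneg ?_
  rw [dist_edgeParam_sq, dist_edgeParam_sq, normalCoord_of_mem n (by linarith) h1,
    normalCoord_of_mem n h0 (by linarith), tangentCoord_of_mem n (by linarith) h1,
    tangentCoord_of_mem n h0 (by linarith)]
  nlinarith

theorem rpoly_pos {n : ℕ} (hn : 6 ≤ n) : 0 < rpoly n := by
  have hn' : (6 : ℝ) ≤ n := by exact_mod_cast hn
  have h := half_lt_cos_pi_div hn
  unfold rpoly
  split_ifs
  · linarith
  · have : 0 ≤ Real.cos (2 * Real.pi / n) := by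
      refine Real.cos_nonneg_of_neg_pi_div_two_le_of_le ?_ ?_
      · have : 0 ≤ 2 * Real.pi / n := by positivity
        linarith [Real.pi_pos]
      · rw [div_le_div_iff₀ (by linarith) (by norm_num)]
        nlinarith [Real.pi_pos]
    have := div_nonneg this (by linarith : 0 ≤ Real.cos (Real.pi / n))
    linarith

theorem dist_edgeParam_level {n : ℕ} (hn : 6 ≤ n) :
    dist (edgeParam n 1) (edgeParam n (polyLevel n)) = rpoly n := by
  have hn' : (6 : ℝ) ≤ n := by exact_mod_cast hn
  have hn0 : (n : ℝ) ≠ 0 := by linarith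
  refine (pow_left_inj₀ dist_nonneg (rpoly_pos hn).le two_ne_zero).1 ?_
  rw [dist_edgeParam_sq, normalCoord_of_mem n zero_le_one le_rfl,
    tangentCoord_of_mem n zero_le_one le_rfl]
  have hcos := half_lt_cos_pi_div hn
  have hx := inv_two_cos_mem hn
  have e2 : 2 * Real.pi / n = 2 * (Real.pi / n) := by ring
  unfold polyLevel rpoly
  rw [e2]
  set θ := Real.pi / n with hθ
  have hnθ : n * θ = Real.pi := by rw [hθ]; field_simp
  split_ifs with he
  · obtain ⟨h, hh⟩ := he
    have e1 : (n : ℝ) = h + h := by exact_mod_cast hh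
    have e3 : (n : ℝ) / 2 = ((h : ℤ) : ℝ) + 0 := by push_cast; linarith
    have e4 : (2 * ((h : ℤ) : ℝ) - 1) * θ = Real.pi - θ := by
      rw [← hnθ, e1]; push_cast; ring
    rw [e3, normalCoord_int_add n h le_rfl zero_le_one, tangentCoord_int_add n h le_rfl zero_le_one,
      ← hθ, e4, Real.cos_pi_sub, Real.sin_pi_sub]
    ring
  · rw [Nat.not_even_iff_odd] at he
    obtain ⟨h, hh⟩ := he
    have e1 : (n : ℝ) = 2 * h + 1 := by exact_mod_cast hh
    have e3 : ((n : ℝ) + 1) / 2 - 1 / (2 * Real.cos θ) =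
        ((h : ℤ) : ℝ) + (1 - 1 / (2 * Real.cos θ)) := by push_cast; rw [e1]; ring
    have e6 : (2 * ((h : ℤ) : ℝ) - 1) * θ = Real.pi - 2 * θ := by
      rw [← hnθ, e1]; push_cast; ring
    have e7 : (2 * ((h : ℤ) : ℝ) + 1) * θ = Real.pi := by rw [← hnθ, e1]; push_cast; ring
    rw [e3, normalCoord_int_add n h (by linarith) (by linarith),
      tangentCoord_int_add n h (by linarith) (by linarith), ← hθ, e6, e7, Real.cos_pi_sub,
      Real.sin_pi_sub, Real.cos_pi, Real.sin_pi, Real.sin_two_mul, Real.cos_two_mul]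
    have : Real.cos θ ≠ 0 := by linarith
    field_simp
    ring

theorem norm_convexComb_le {a b : ℂ} {M w : ℝ} (ha : ‖a‖ ≤ M) (hb : ‖b‖ ≤ M) (h0 : 0 ≤ w)
    (h1 : w ≤ 1) : ‖((1 - w : ℝ) : ℂ) * a + (w : ℂ) * b‖ ≤ M := by
  refine (norm_add_le _ _).trans ?_
  rw [norm_mul, norm_mul, Complex.norm_of_nonneg h0, Complex.norm_of_nonneg (by linarith)]
  nlinarith

theorem edgeParam_lerp (n : ℕ) (k : ℤ) {a b w : ℝ} (ha : k ≤ a) (ha' : a ≤ k + 1) (hb : k ≤ b)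
    (hb' : b ≤ k + 1) (h0 : 0 ≤ w) (h1 : w ≤ 1) :
    edgeParam n ((1 - w) * a + w * b) =
      ((1 - w : ℝ) : ℂ) * edgeParam n a + (w : ℂ) * edgeParam n b := by
  have e : ∀ s : ℝ, k ≤ s → s ≤ k + 1 →
      edgeParam n s = (1 - (s - k) : ℝ) * nroot n ^ k + ((s - k : ℝ) : ℂ) * nroot n ^ (k + 1) := by
    intro s hs hs'
    rw [← edgeParam_int_add n k (by linarith) (by linarith), add_sub_cancel]
  rw [e a ha ha', e b hb hb', e _ (by nlinarith) (by nlinarith)]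
  push_cast
  ring

theorem dist_edgeParam_le_zero (n : ℕ) (x t : ℝ) :
    dist (edgeParam n x) (edgeParam n (x + t)) ≤ dist (edgeParam n 0) (edgeParam n t) := by
  have key : ∀ (k j : ℤ) (a b w : ℝ), k ≤ a → a ≤ k + 1 → k ≤ b → b ≤ k + 1 → j ≤ a + t →
      a + t ≤ j + 1 → j ≤ b + t → b + t ≤ j + 1 → 0 ≤ w → w ≤ 1 →
      dist (edgeParam n a) (edgeParam n (a + t)) ≤ dist (edgeParam n 0) (edgeParam n t) →
      dist (edgeParam n b) (edgeParam n (b + t)) ≤ dist (edgeParam n 0) (edgeParam n t) →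
      dist (edgeParam n ((1 - w) * a + w * b)) (edgeParam n ((1 - w) * a + w * b + t)) ≤
        dist (edgeParam n 0) (edgeParam n t) := by
    intro k j a b w h1 h2 h3 h4 h5 h6 h7 h8 h9 h10 ha hb
    rw [dist_eq_norm] at ha hb
    have e : (1 - w) * a + w * b + t = (1 - w) * (a + t) + w * (b + t) := by ring
    rw [e, edgeParam_lerp n k h1 h2 h3 h4 h9 h10, edgeParam_lerp n j h5 h6 h7 h8 h9 h10,
      dist_eq_norm, add_sub_add_comm, ← mul_sub, ← mul_sub]
    exact norm_convexComb_le ha hb h9 h10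
  wlog hx : 0 ≤ x ∧ x < 1 generalizing x
  · have := this (Int.fract x) ⟨Int.fract_nonneg x, Int.fract_lt_one x⟩
    rw [← dist_edgeParam_add_int n _ _ ⌊x⌋, add_right_comm, Int.fract_add_floor] at this
    exact this
  obtain ⟨h0, h1⟩ := hx
  have hf0 := Int.fract_nonneg t
  have hf1 := Int.fract_lt_one t
  have hfl := Int.floor_add_fract t
  have hend : dist (edgeParam n 1) (edgeParam n (1 + t)) ≤
      dist (edgeParam n 0) (edgeParam n t) := by
    rw [← dist_edgeParam_add_int n 0 t 1]
    simp [add_comm]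
  have hmid : dist (edgeParam n (1 - Int.fract t)) (edgeParam n (1 - Int.fract t + t)) ≤
      dist (edgeParam n 0) (edgeParam n t) := by
    rw [← dist_edgeParam_neg n 0 t, ← dist_edgeParam_add_int n (-t) _ (⌊t⌋ + 1)]
    refine (congrArg₂ _ (congrArg _ ?_) (congrArg _ ?_)).le
    · push_cast; linarith
    · push_cast; linarith
  have hzero : dist (edgeParam n 0) (edgeParam n (0 + t)) ≤
      dist (edgeParam n 0) (edgeParam n t) := by rw [zero_add]
  rcases le_or_gt x (1 - Int.fract t) with hxt | hxt
  · have hw : x = (1 - x / (1 - Int.fract t)) * 0 + x / (1 - Int.fract t) * (1 - Int.fract t) := by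
      have : 1 - Int.fract t ≠ 0 := by linarith
      field_simp
      ring
    rw [hw]
    refine key 0 ⌊t⌋ 0 (1 - Int.fract t) _ ?_ ?_ ?_ ?_ ?_ ?_ ?_ ?_
      (div_nonneg h0 (by linarith)) (div_le_one_of_le₀ hxt (by linarith)) hzero hmid
    all_goals (try push_cast); linarith
  · have hf : 0 < Int.fract t := by linarith
    have hw : x = (1 - (x - (1 - Int.fract t)) / Int.fract t) * (1 - Int.fract t) +
        (x - (1 - Int.fract t)) / Int.fract t * 1 := by
      field_simp
      ring
    rw [hw]
    refine key 0 (⌊t⌋ + 1) (1 - Int.fract t) 1 _ ?_ ?_ ?_ ?_ ?_ ?_ ?_ ?_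
      (div_nonneg (by linarith) hf.le) (div_le_one_of_le₀ (by linarith) hf.le) hmid hend
    all_goals (try push_cast); linarith

/-- The Euclidean distance between the points of `P_n` with parameters `x` and `y`. -/
noncomputable def chord (n : ℕ) (x y : ℝ) : ℝ := dist (edgeParam n x) (edgeParam n y)

theorem isChordFun_chord {n : ℕ} (hn : 6 ≤ n) : IsChordFun (chord n) (polyLevel n) (rpoly n) where
  cont := (continuous_edgeParam.comp continuous_fst).dist (continuous_edgeParam.comp continuous_snd)
  self x := dist_self _
  shift x y := by simpa [chord] using dist_edgeParam_add_int n x y 1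
  reflect x y := dist_edgeParam_neg n x y
  anti_edge x x' z h0 hx h1 hz hb := dist_edgeParam_lt hn h0 hx h1 hz hb
  at_level := dist_edgeParam_level hn
  le_zero x t _ := dist_edgeParam_le_zero n x t
  one_le := one_le_polyLevel hn
  pos := rpoly_pos hn

theorem edgeParam_eq_of_mem {n : ℕ} (hn : 6 ≤ n) {a b : ℝ} (ha0 : 0 ≤ a) (ha1 : a < 1) (hb0 : 0 ≤ b)
    (hbn : b < n) (h : edgeParam n a = edgeParam n b) : a = b := by
  have hn' : (6 : ℝ) ≤ n := by exact_mod_cast hn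
  have hn0 : (n : ℝ) ≠ 0 := by linarith
  have hs := sin_pi_div_pos hn
  have hN : normalCoord n a = normalCoord n b := by rw [normalCoord, normalCoord, h]
  have hT : tangentCoord n a = tangentCoord n b := by rw [tangentCoord, tangentCoord, h]
  rw [tangentCoord_of_mem n ha0 ha1.le] at hT
  rcases le_or_gt b 1 with hb1 | hb1
  · rw [tangentCoord_of_mem n hb0 hb1] at hT
    have := mul_right_cancel₀ hs.ne' hT
    linarith
  · exfalso
    have hf0 := Int.fract_nonneg b
    have hf1 := Int.fract_lt_one b
    have hfl := Int.floor_add_fract b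
    have hk : 1 ≤ ⌊b⌋ := Int.le_floor.2 (by simpa using hb1.le)
    have hk' : ⌊b⌋ ≤ n - 1 := by
      have : ⌊b⌋ < n := Int.floor_lt.2 (by simpa using hbn)
      omega
    have hk1 : (1 : ℝ) ≤ ⌊b⌋ := by exact_mod_cast hk
    have hk2 : (⌊b⌋ : ℝ) ≤ n - 1 := by exact_mod_cast hk'
    rw [normalCoord_of_mem n ha0 ha1.le, ← hfl, normalCoord_int_add n _ hf0 hf1.le] at hN
    set θ := Real.pi / n with hθ
    have hθ0 : 0 < θ := by positivity
    have hnθ : n * θ = Real.pi := by rw [hθ]; field_simp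
    rcases hk.eq_or_lt with e | hk3
    · have hf : 0 < Int.fract b := by
        have : (⌊b⌋ : ℝ) = 1 := by exact_mod_cast e.symm
        linarith
      have e' : (⌊b⌋ : ℝ) = 1 := by exact_mod_cast e.symm
      have hc : Real.cos ((2 * ⌊b⌋ + 1) * θ) < Real.cos θ := by
        refine cos_lt_cos_of_lt_of_lt_two_pi_sub hθ0.le ?_ ?_
        · rw [e']; nlinarith
        · rw [e', ← hnθ]; nlinarith
      have e2 : (2 * (⌊b⌋ : ℝ) - 1) * θ = θ := by rw [e']; ring
      rw [e2] at hN
      nlinarith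
    · have hk4 : (2 : ℝ) ≤ ⌊b⌋ := by exact_mod_cast hk3
      have hc : Real.cos ((2 * ⌊b⌋ - 1) * θ) < Real.cos θ := by
        refine cos_lt_cos_of_lt_of_lt_two_pi_sub hθ0.le ?_ ?_
        · nlinarith
        · rw [← hnθ]; nlinarith
      have hc' : Real.cos ((2 * ⌊b⌋ + 1) * θ) ≤ Real.cos θ := by
        rcases hk2.eq_or_lt with e | hl
        · have e2 : (2 * (⌊b⌋ : ℝ) + 1) * θ = 2 * Real.pi - θ := by rw [e, ← hnθ]; ring
          rw [e2, Real.cos_two_pi_sub]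
        · have hl' : (⌊b⌋ : ℝ) ≤ n - 2 := by
            have : ⌊b⌋ < n - 1 := by exact_mod_cast hl
            have : ⌊b⌋ ≤ n - 2 := by omega
            exact_mod_cast this
          refine (cos_lt_cos_of_lt_of_lt_two_pi_sub hθ0.le ?_ ?_).le
          · nlinarith
          · rw [← hnθ]; nlinarith
      nlinarith

theorem edgeParam_add_mul {n : ℕ} (hn : n ≠ 0) (s : ℝ) (k : ℤ) :
    edgeParam n (s + k * n) = edgeParam n s := by
  have := edgeParam_add_int n s (k * n)
  push_cast at this
  rw [this, nroot_zpow_mul_self hn, one_mul]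

theorem edgeParam_eq_iff {n : ℕ} (hn : 6 ≤ n) (s s' : ℝ) :
    edgeParam n s = edgeParam n s' ↔ ∃ k : ℤ, s' = s + k * n := by
  constructor
  · intro h
    have hn0 : (0 : ℝ) < n := by exact_mod_cast (by omega : 0 < n)
    have hs := Int.floor_add_fract s
    set b := Int.fract ((s' - ⌊s⌋) / n) * n with hb
    have hbs : s' = (b + ⌊((s' - ⌊s⌋) / n : ℝ)⌋ * n) + ⌊s⌋ := by
      rw [hb, ← add_mul, Int.fract_add_floor]
      field_simp
      ring
    have h1 : edgeParam n (Int.fract s) = edgeParam n b := by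
      rw [hbs] at h
      nth_rewrite 1 [← Int.fract_add_floor s] at h
      rw [edgeParam_add_int, edgeParam_add_int, edgeParam_add_mul (by omega)] at h
      exact mul_left_cancel₀ (zpow_ne_zero _ (nroot_ne_zero n)) h
    have h2 := edgeParam_eq_of_mem hn (Int.fract_nonneg s) (Int.fract_lt_one s)
      (mul_nonneg (Int.fract_nonneg _) hn0.le)
      (by have := Int.fract_lt_one ((s' - ⌊s⌋) / n : ℝ); nlinarith) h1
    refine ⟨⌊((s' - ⌊s⌋) / n : ℝ)⌋, ?_⟩
    linarith
  · rintro ⟨k, rfl⟩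
    exact (edgeParam_add_mul (by omega) s k).symm

theorem exists_nat_lt_zpow_eq {n : ℕ} (hn : 6 ≤ n) (k : ℤ) :
    ∃ j < n, ∃ a : ℤ, k = j + a * n := by
  have hn0 : (0 : ℤ) < n := by exact_mod_cast (by omega : 0 < n)
  refine ⟨(k % n).toNat, ?_, k / n, ?_⟩
  · have := Int.emod_lt_of_pos k hn0
    omega
  · rw [Int.toNat_of_nonneg (Int.emod_nonneg _ hn0.ne'), mul_comm]
    exact (Int.emod_add_mul_ediv k n).symm

theorem mem_polygon_iff {n : ℕ} (hn : 6 ≤ n) (x : ℂ) : x ∈ polygon n ↔ ∃ s, edgeParam n s = x := by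
  simp only [polygon, Set.mem_iUnion, Finset.mem_range, segment_eq_image, Set.mem_image]
  constructor
  · rintro ⟨j, -, f, ⟨h0, h1⟩, rfl⟩
    refine ⟨(j : ℤ) + f, ?_⟩
    rw [edgeParam_int_add n j h0 h1, Complex.real_smul, Complex.real_smul, zpow_natCast,
      ← zpow_natCast (nroot n) (j + 1)]
    push_cast
    rfl
  · rintro ⟨s, rfl⟩
    obtain ⟨j, hj, a, ha⟩ := exists_nat_lt_zpow_eq hn ⌊s⌋
    refine ⟨j, hj, Int.fract s, ⟨Int.fract_nonneg s, (Int.fract_lt_one s).le⟩, ?_⟩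
    have hs : s = ((j : ℤ) + Int.fract s) + a * n := by
      have : (⌊s⌋ : ℝ) = j + a * n := by exact_mod_cast ha
      have := Int.floor_add_fract s
      push_cast
      linarith
    conv_rhs => rw [hs, edgeParam_add_mul (by omega),
      edgeParam_int_add n j (Int.fract_nonneg s) (Int.fract_lt_one s).le]
    rw [Complex.real_smul, Complex.real_smul, zpow_natCast, ← zpow_natCast (nroot n) (j + 1)]
    push_cast
    rfl

theorem edgeParam_mem_polygon {n : ℕ} (hn : 6 ≤ n) (s : ℝ) : edgeParam n s ∈ polygon n :=
  (mem_polygon_iff hn _).2 ⟨s, rfl⟩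

theorem isVertex_iff {n : ℕ} (hn : 6 ≤ n) (x : ℂ) :
    IsVertex n x ↔ ∃ k : ℤ, x = edgeParam n (0 + k) := by
  constructor
  · rintro ⟨j, -, rfl⟩
    exact ⟨j, by rw [zero_add, edgeParam_intCast, zpow_natCast]⟩
  · rintro ⟨k, rfl⟩
    obtain ⟨j, hj, a, rfl⟩ := exists_nat_lt_zpow_eq hn k
    refine ⟨j, hj, ?_⟩
    rw [zero_add, edgeParam_intCast, zpow_add₀ (nroot_ne_zero n), nroot_zpow_mul_self (by omega),
      mul_one, zpow_natCast]

theorem isMidpoint_iff {n : ℕ} (hn : 6 ≤ n) (x : ℂ) :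
    IsMidpoint n x ↔ ∃ k : ℤ, x = edgeParam n (1 / 2 + k) := by
  have hmid : ∀ j : ℕ, (nroot n ^ j + nroot n ^ (j + 1)) / 2 = edgeParam n (1 / 2 + (j : ℤ)) := by
    intro j
    rw [add_comm (1 / 2 : ℝ), edgeParam_int_add n j (by norm_num) (by norm_num), zpow_natCast,
      ← zpow_natCast (nroot n) (j + 1)]
    push_cast
    ring
  constructor
  · rintro ⟨j, -, rfl⟩
    exact ⟨j, hmid j⟩
  · rintro ⟨k, rfl⟩
    obtain ⟨j, hj, a, rfl⟩ := exists_nat_lt_zpow_eq hn k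
    refine ⟨j, hj, ?_⟩
    rw [hmid, ← edgeParam_add_mul (by omega) (1 / 2 + ((j : ℤ) : ℝ)) a]
    congr 1
    push_cast
    ring

theorem polyArg_edgeParam {n : ℕ} (hn : 6 ≤ n) (s : ℝ) :
    polyArg n (edgeParam n s) = Int.fract (s / n) := by
  have hn0 : (n : ℝ) ≠ 0 := by exact_mod_cast (by omega : n ≠ 0)
  have : {t : ℝ | t ∈ Set.Ico (0 : ℝ) 1 ∧ polyParam n t = edgeParam n s} =
      {Int.fract (s / n)} := by
    ext t
    simp only [Set.mem_ofPred_eq, Set.mem_singleton_iff, polyParam_eq_edgeParam,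
      edgeParam_eq_iff hn, Set.mem_Ico]
    constructor
    · rintro ⟨⟨h0, h1⟩, k, rfl⟩
      refine (Int.fract_eq_iff.2 ⟨h0, h1, k, ?_⟩).symm
      field_simp
      ring
    · rintro rfl
      refine ⟨⟨Int.fract_nonneg _, Int.fract_lt_one _⟩, ⌊s / n⌋, ?_⟩
      have := Int.fract_add_floor (s / n)
      rw [mul_comm, ← add_mul, this]
      field_simp
  rw [polyArg, this, csInf_singleton]

theorem polyDist_edgeParam {n : ℕ} (hn : 6 ≤ n) (s s' : ℝ) :
    polyDist n (edgeParam n s) (edgeParam n s') = Int.fract ((s' - s) / n) := by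
  rw [polyDist, polyArg_edgeParam hn, polyArg_edgeParam hn, Int.fract_eq_fract]
  refine ⟨⌊s / n⌋ - ⌊s' / n⌋, ?_⟩
  rw [Int.fract, Int.fract]
  push_cast
  ring

theorem polyDist_edgeParam_of_mem {n : ℕ} (hn : 6 ≤ n) {s s' : ℝ} (h : s ≤ s') (h' : s' < s + n) :
    polyDist n (edgeParam n s) (edgeParam n s') = (s' - s) / n := by
  have hn0 : (0 : ℝ) < n := by exact_mod_cast (by omega : 0 < n)
  rw [polyDist_edgeParam hn, Int.fract_eq_self]
  exact ⟨div_nonneg (by linarith) hn0.le, (div_lt_one hn0).2 (by linarith)⟩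

theorem nextPt_lt_add {n : ℕ} (hn : 6 ≤ n) {r : ℝ} (hr : r ≤ rpoly n) (x : ℝ) :
    nextPt (chord n) r x < x + n := by
  have h := (isChordFun_chord hn).nextPt_le_level hr ⌊x⌋ (Int.floor_le x)
    (Int.lt_floor_add_one x).le
  have := polyLevel_lt hn
  have := Int.floor_le x
  linarith

/-- The defining condition of a side of a star determines its endpoint as `nextPt`. -/
theorem nextPt_of_side {n : ℕ} (hn : 6 ≤ n) {r : ℝ} (h0 : 0 < r) (hr : r ≤ rpoly n) {x : ℝ} {v : ℂ}
    (hv : v ∈ polygon n) (hd : dist (edgeParam n x) v = r)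
    (hz : ∀ z ∈ polygon n, SCCWBtw n (edgeParam n x) z v → dist (edgeParam n x) z < r) :
    edgeParam n (nextPt (chord n) r x) = v ∧
      nextPt (chord n) r x = x + n * polyDist n (edgeParam n x) v := by
  have hn0 : (0 : ℝ) < n := by exact_mod_cast (by omega : 0 < n)
  obtain ⟨w, rfl⟩ := (mem_polygon_iff hn v).1 hv
  set d := polyDist n (edgeParam n x) (edgeParam n w) with hdd
  have hd' : d = Int.fract ((w - x) / n) := polyDist_edgeParam hn x w
  have hd0 : 0 ≤ d := hd' ▸ Int.fract_nonneg _
  have hd1 : d < 1 := hd' ▸ Int.fract_lt_one _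
  have hw : w = x + n * d + ⌊(w - x) / n⌋ * n := by
    have := Int.fract_add_floor ((w - x) / n)
    rw [← hd', eq_div_iff hn0.ne'] at this
    linarith
  have hyw : edgeParam n (x + n * d) = edgeParam n w := by
    conv_rhs => rw [hw, edgeParam_add_mul (by omega)]
  have key : nextPt (chord n) r x = x + n * d := by
    refine (isChordFun_chord hn).nextPt_eq h0 hr (by nlinarith) (by rw [chord, hyw, hd]) ?_
    intro z hxz hzy
    refine hz _ (edgeParam_mem_polygon hn z) ?_
    rw [SCCWBtw, polyDist_edgeParam_of_mem hn hxz.le (by nlinarith), ← hdd]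
    exact ⟨div_pos (by linarith) hn0, by rw [div_lt_iff₀ hn0]; linarith⟩
  exact ⟨by rw [key, hyw], key⟩

theorem iterate_of_isStar {n l : ℕ} (hn : 6 ≤ n) {r : ℝ} (h0 : 0 < r) (hr : r ≤ rpoly n) {p : ℂ}
    {u : ℕ → ℂ} (hu : IsStar n l r p u) {s : ℝ} (hs : edgeParam n s = p) :
    (∀ i ≤ 2 * l + 1, edgeParam n ((nextPt (chord n) r)^[i] s) = u i) ∧
      (nextPt (chord n) r)^[2 * l + 1] s = s + l * n := by
  obtain ⟨hu0, -, hmem, hdist, hbtw, hsum⟩ := hu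
  have key : ∀ i ≤ 2 * l + 1, edgeParam n ((nextPt (chord n) r)^[i] s) = u i ∧
      (nextPt (chord n) r)^[i] s =
        s + n * ∑ j ∈ Finset.range i, polyDist n (u j) (u (j + 1)) := by
    intro i
    induction i with
    | zero => intro _; simp [hu0, hs]
    | succ i ih =>
      intro hi
      obtain ⟨h1, h2⟩ := ih (by omega)
      have := nextPt_of_side hn h0 hr (x := (nextPt (chord n) r)^[i] s) (hmem (i + 1) hi)
        (by rw [h1]; exact hdist i (by omega)) (by rw [h1]; exact hbtw i (by omega))
      rw [Function.iterate_succ_apply', Finset.sum_range_succ]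
      refine ⟨this.1, ?_⟩
      rw [this.2, h1]
      nth_rewrite 1 [h2]
      ring
  refine ⟨fun i hi => (key i hi).1, ?_⟩
  rw [(key _ le_rfl).2, hsum, mul_comm]

theorem isStar_iterate {n l : ℕ} (hn : 6 ≤ n) {r : ℝ} (h0 : 0 < r) (hr : r ≤ rpoly n) {s : ℝ}
    (hs : (nextPt (chord n) r)^[2 * l + 1] s = s + l * n) :
    IsStar n l r (edgeParam n s) fun i => edgeParam n ((nextPt (chord n) r)^[i] s) := by
  have hC := isChordFun_chord hn
  have hn0 : (n : ℝ) ≠ 0 := by exact_mod_cast (by omega : n ≠ 0)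
  have hpd : ∀ i, polyDist n (edgeParam n ((nextPt (chord n) r)^[i] s))
      (edgeParam n ((nextPt (chord n) r)^[i + 1] s)) =
      ((nextPt (chord n) r)^[i + 1] s) / n - ((nextPt (chord n) r)^[i] s) / n := by
    intro i
    rw [Function.iterate_succ_apply', ← sub_div]
    exact polyDist_edgeParam_of_mem hn (hC.le_nextPt hr _) (nextPt_lt_add hn hr _)
  refine ⟨rfl, ?_, fun i _ => edgeParam_mem_polygon hn _, fun i _ => ?_, fun i _ z hz hb => ?_, ?_⟩
  · have := edgeParam_add_mul (n := n) (by omega) s l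
    push_cast at this
    simp only [hs, this]
  · simp only [Function.iterate_succ_apply']
    exact hC.chord_nextPt h0.le hr _
  · obtain ⟨w, rfl⟩ := (mem_polygon_iff hn z).1 hz
    simp only [SCCWBtw] at hb
    rw [hpd] at hb
    set x := (nextPt (chord n) r)^[i] s with hx
    have hpos : (0 : ℝ) < n := by exact_mod_cast (by omega : 0 < n)
    set d := Int.fract ((w - x) / n) with hd
    rw [polyDist_edgeParam hn, ← hd, ← sub_div, Function.iterate_succ_apply', ← hx,
      lt_div_iff₀ hpos] at hb
    have hw : edgeParam n w = edgeParam n (x + n * d) := by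
      rw [← edgeParam_add_mul (by omega) (x + n * d) ⌊(w - x) / n⌋]
      congr 1
      have := Int.fract_add_floor ((w - x) / n)
      rw [← hd, eq_div_iff hn0] at this
      linarith
    rw [hw]
    exact IsChordFun.lt_of_lt_nextPt (D := chord n) (by nlinarith [hb.1]) (by linarith [hb.2])
  · simp only [hpd]
    rw [Finset.sum_range_sub (fun i => (nextPt (chord n) r)^[i] s / n), hs]
    simp only [Function.iterate_zero, id]
    field_simp
    ring

/-- The number of base points of stars through a point of a class of points of the polygon that is
the orbit of a single point under the rotations of the polygon. -/
theorem crossings_ncard {l n : ℕ} (hl : 1 ≤ l) (hn : 4 * l + 2 ≤ n) {c : ℝ} {Q : ℂ → Prop}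
    (hQ : ∀ x, Q x ↔ ∃ k : ℤ, x = edgeParam n (c + k)) :
    {p ∈ polygon n | ∃ r : ℝ, ∃ u : ℕ → ℂ, 0 < r ∧ r ≤ rpoly n ∧ IsStar n l r p u ∧
        ∃ i ≤ 2 * l, Q (u i)}.Finite ∧
      {p ∈ polygon n | ∃ r : ℝ, ∃ u : ℕ → ℂ, 0 < r ∧ r ≤ rpoly n ∧ IsStar n l r p u ∧
        ∃ i ≤ 2 * l, Q (u i)}.ncard = Nat.lcm n (2 * l + 1) := by
  have hn6 : 6 ≤ n := by omega
  have hn0 : (0 : ℝ) < n := by exact_mod_cast (by omega : 0 < n)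
  have hl0 : (0 : ℝ) < l := by exact_mod_cast (by omega : 0 < l)
  have hC := isChordFun_chord hn6
  obtain ⟨r, ⟨h0, hr, he⟩, huniq⟩ := hC.existsUnique_iterate_eq c (m := 2 * l + 1) (by omega)
    (mul_pos hl0 hn0) (mul_le_mul_polyLevel hl hn)
  have hset : {p ∈ polygon n | ∃ r : ℝ, ∃ u : ℕ → ℂ, 0 < r ∧ r ≤ rpoly n ∧ IsStar n l r p u ∧
        ∃ i ≤ 2 * l, Q (u i)} =
      {p | ∃ (i : ℕ) (j : ℤ), p = edgeParam n ((nextPt (chord n) r)^[i] c + j)} := by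
    ext p
    simp only [Set.mem_ofPred_eq]
    constructor
    · rintro ⟨hp, r', u, h0', hr', hu, i, hi, hq⟩
      obtain ⟨s, hs⟩ := (mem_polygon_iff hn6 p).1 hp
      obtain ⟨hit, hper⟩ := iterate_of_isStar hn6 h0' hr' hu hs
      obtain ⟨k, hk⟩ := (hQ _).1 hq
      rw [← hit i (by omega), eq_comm, edgeParam_eq_iff hn6] at hk
      obtain ⟨a, ha⟩ := hk
      have ha' : (nextPt (chord n) r')^[i] s = c + ((k + a * n : ℤ) : ℝ) := by
        rw [ha]; push_cast; ring
      have hrr : r' = r := by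
        refine huniq r' ⟨h0', hr', ?_⟩
        have h1 := hC.iterate_add_int hr' c (k + a * n) (2 * l + 1)
        have h2 := hC.iterate_add_int hr' s (l * n) i
        push_cast at h2
        rw [← ha', ← Function.iterate_add_apply, add_comm, Function.iterate_add_apply, hper, h2,
          ha'] at h1
        linarith
      subst hrr
      refine ⟨2 * l + 1 - i, k + a * n, ?_⟩
      rw [← hC.iterate_add_int hr', ← ha', ← Function.iterate_add_apply,
        Nat.sub_add_cancel (by omega), hper, ← hs, edgeParam_eq_iff hn6]
      exact ⟨l, by push_cast; ring⟩
    · rintro ⟨i, j, rfl⟩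
      have hcomm : ∀ (i : ℕ), (nextPt (chord n) r)^[2 * l + 1] ((nextPt (chord n) r)^[i] c) =
          (nextPt (chord n) r)^[i] c + l * n := by
        intro i
        have := hC.iterate_add_int hr c (l * n) i
        push_cast at this
        rw [← Function.iterate_add_apply, add_comm, Function.iterate_add_apply, he, this]
      have hper : (nextPt (chord n) r)^[2 * l + 1] ((nextPt (chord n) r)^[i] c + j) =
          (nextPt (chord n) r)^[i] c + j + l * n := by
        rw [hC.iterate_add_int hr, hcomm]
        ring
      refine ⟨edgeParam_mem_polygon hn6 _, r, _, h0, hr, isStar_iterate hn6 h0 hr hper, ?_⟩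
      obtain ⟨a, ha⟩ : ∃ a, a = i / (2 * l + 1) := ⟨_, rfl⟩
      have hmod := Nat.mod_lt i (by omega : 0 < 2 * l + 1)
      have hdiv := Nat.mod_add_div i (2 * l + 1)
      rw [← ha] at hdiv
      have hmul : (nextPt (chord n) r)^[(2 * l + 1) * (a + 1)] c =
          c + ((a + 1 : ℕ) : ℝ) * ((l * n : ℤ) : ℝ) :=
        iterate_mul_period (fun x j => hC.nextPt_add_int hr x j) (by rw [he]; push_cast; rfl) _
      rcases Nat.eq_zero_or_pos (i % (2 * l + 1)) with e | hpos
      · refine ⟨0, by omega, (hQ _).2 ?_⟩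
        have hmul' : (nextPt (chord n) r)^[(2 * l + 1) * a] c =
            c + ((a : ℕ) : ℝ) * ((l * n : ℤ) : ℝ) :=
          iterate_mul_period (fun x j => hC.nextPt_add_int hr x j) (by rw [he]; push_cast; rfl) _
        refine ⟨a * (l * n) + j, ?_⟩
        have hi : (2 * l + 1) * a = i := by omega
        rw [hi] at hmul'
        rw [Function.iterate_zero, id, hmul']
        congr 1
        push_cast
        ring
      · refine ⟨2 * l + 1 - i % (2 * l + 1), by omega, (hQ _).2 ?_⟩
        refine ⟨(a + 1) * (l * n) + j, ?_⟩
        have hi : 2 * l + 1 - i % (2 * l + 1) + i = (2 * l + 1) * (a + 1) := by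
          rw [mul_add, mul_one]
          omega
        rw [hC.iterate_add_int hr, ← Function.iterate_add_apply, hi, hmul]
        congr 1
        push_cast
        ring
  rw [hset]
  exact orbit_ncard (hC.strictMono_nextPt hr) (fun x j => hC.nextPt_add_int hr x j) (by omega) he
    (edgeParam_eq_iff hn6)

/-- The number of vertex crossings and the number of midpoint crossings in `P_n` are each
`lcm(n, 2l+1)`: the set of points `p ∈ P_n` admitting an inscribed equilateral
`(2l+1)`-pointed star (side length in `(0, r_n]`) based at `p` that contains a vertex of
`P_n` (resp. a midpoint of an edge of `P_n`) among its points is finite with exactly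
`lcm(n, 2l+1)` elements. -/
theorem num_crossings (l n : ℕ) (hl : 1 ≤ l) (hn : 4 * l + 2 ≤ n) :
    ({p ∈ polygon n | ∃ r : ℝ, ∃ u : ℕ → ℂ, 0 < r ∧ r ≤ rpoly n ∧ IsStar n l r p u ∧
        ∃ i ≤ 2 * l, IsVertex n (u i)}.Finite ∧
      {p ∈ polygon n | ∃ r : ℝ, ∃ u : ℕ → ℂ, 0 < r ∧ r ≤ rpoly n ∧ IsStar n l r p u ∧
        ∃ i ≤ 2 * l, IsVertex n (u i)}.ncard = Nat.lcm n (2 * l + 1)) ∧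
    ({p ∈ polygon n | ∃ r : ℝ, ∃ u : ℕ → ℂ, 0 < r ∧ r ≤ rpoly n ∧ IsStar n l r p u ∧
        ∃ i ≤ 2 * l, IsMidpoint n (u i)}.Finite ∧
      {p ∈ polygon n | ∃ r : ℝ, ∃ u : ℕ → ℂ, 0 < r ∧ r ≤ rpoly n ∧ IsStar n l r p u ∧
        ∃ i ≤ 2 * l, IsMidpoint n (u i)}.ncard = Nat.lcm n (2 * l + 1)) := by
  exact ⟨crossings_ncard hl hn (isVertex_iff (by omega)),
    crossings_ncard hl hn (isMidpoint_iff (by omega))⟩
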